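/- Let G be a group generated by a finite set S′ and let F be the free group on a finite set S; equip G with the word length for S′, and equip G ≀ F with the word length for S ∪ S′ (where G is embedded as functions supported at 1 and F as the second factor). For a group K with a fixed word length |·|, let B₁(K) be the supremum of all d ∈ [0,1] such that there exists a left-invariant measured walls structure μ on K with d_μ(1,k) ≥ |k|^d for all k ∈ K. Then B₁(G ≀ F) = B₁(G). -/

import Mathlib

open MeasureTheory Function Set
open scoped ENNReal
/-- A Borel measure on the power set `2^X`, identified with `X → Bool` endowed with the
product topology (and its Borel σ-algebra). -/
noncomputable abbrev WallMeasure (X : Type*) := @MeasureTheory.Measure (X → Bool) (borel _)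

/-- The pseudo-distance associated to a wall measure:
`d_μ(x,y) = μ {A | exactly one of x, y belongs to A}`. -/
def wallDist {X : Type*} (μ : WallMeasure X) (x y : X) : ℝ≥0∞ :=
  μ {A | A x ≠ A y}

/-- A measured walls structure: all wall pseudo-distances are finite. -/
def IsMWS {X : Type*} (μ : WallMeasure X) : Prop :=
  ∀ x y : X, wallDist μ x y < ⊤

/-- Pushforward of wall measures. -/
noncomputable def wallMap {X Y : Type*} (f : (X → Bool) → (Y → Bool)) (μ : WallMeasure X) :
    WallMeasure Y :=
  @MeasureTheory.Measure.map _ _ (borel _) (borel _) f μ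

/-- Left invariance of a wall measure on a group, for the action `(k·A)(x) = A(k⁻¹x)`. -/
def IsLeftInvariantWalls {K : Type*} [Group K] (μ : WallMeasure K) : Prop :=
  ∀ k : K, wallMap (fun A x => A (k⁻¹ * x)) μ = μ

/-- `A ⊢ F` : the half-space `A` cuts the subset `F`, i.e. `F` is neither contained in `A`
nor in its complement. -/
def CutsB {X : Type*} (A : X → Bool) (F : Set X) : Prop :=
  (∃ x ∈ F, A x = true) ∧ (∃ x ∈ F, A x = false)
/-- Word length with respect to a generating set `T` (elements of `T` and their inverses). -/
noncomputable def wordLength {K : Type*} [Group K] (T : Set K) (k : K) : ℕ :=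
  sInf {n | ∃ l : List K, l.length = n ∧ (∀ x ∈ l, x ∈ T ∨ x⁻¹ ∈ T) ∧ l.prod = k}
/-- The group of finitely supported functions `X → H` under pointwise multiplication. -/
def FinSuppSubgroup (H : Type*) [Group H] (X : Type*) : Subgroup (X → H) where
  carrier := {w | (Function.mulSupport w).Finite}
  one_mem' := by simpa [Function.mulSupport_one] using Set.finite_empty
  mul_mem' := by
    intro a b ha hb
    exact (ha.union hb).subset (Function.mulSupport_mul a b)
  inv_mem' := by
    intro a ha
    simpa [Function.mulSupport_inv] using ha

/-- The shift action of `G` on finitely supported functions `X → H`, for a `G`-set `X`: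
`(g·w)(x) = w(g⁻¹ • x)`. -/
def wreathShift (H : Type*) [Group H] (X : Type*) (G : Type*) [Group G] [MulAction G X] :
    G →* MulAut (FinSuppSubgroup H X) where
  toFun g :=
    { toFun := fun w => ⟨fun x => (w : X → H) (g⁻¹ • x), by
        refine (w.2.image (fun x => g • x)).subset ?_
        intro x hx
        exact ⟨g⁻¹ • x, hx, by simp⟩⟩
      invFun := fun w => ⟨fun x => (w : X → H) (g • x), by
        refine (w.2.image (fun x => g⁻¹ • x)).subset ?_
        intro x hx
        exact ⟨g • x, hx, by simp⟩⟩
      left_inv := by intro w; apply Subtype.ext; funext x; simp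
      right_inv := by intro w; apply Subtype.ext; funext x; simp
      map_mul' := by intro a b; rfl }
  map_one' := by
    apply MulEquiv.ext; intro w; apply Subtype.ext; funext x; simp
  map_mul' := by
    intro a b
    apply MulEquiv.ext; intro w; apply Subtype.ext; funext x
    simp [mul_smul]

/-- The permutational wreath product `H ≀_X G = H^{(X)} ⋊ G`. -/
abbrev PermWreath (H : Type*) [Group H] (X : Type*) (G : Type*) [Group G] [MulAction G X] :=
  FinSuppSubgroup H X ⋊[wreathShift H X G] G

/-- The standard wreath product `H ≀ G = H^{(G)} ⋊ G`. -/
abbrev StandardWreath (H : Type*) [Group H] (G : Type*) [Group G] := PermWreath H G G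

open scoped Classical in
/-- The copy of `h : H` in `H^{(F)}` supported at the identity of `F`. -/
noncomputable def atOne {H F : Type*} [Group H] [Group F] (h : H) : FinSuppSubgroup H F :=
  ⟨fun x => if x = 1 then h else 1, by
    refine (Set.finite_singleton (1 : F)).subset ?_
    intro x hx
    by_contra hne
    exact hx (if_neg hne)⟩

/-- The canonical generating set `S ∪ S'` of the wreath product `H ≀ F(S)`, where `H` is
embedded as functions supported at `1` and the free group `F(S)` as the second factor. -/
noncomputable def wreathGen {H : Type*} [Group H] (S' : Set H) (S : Type*) :
    Set (StandardWreath H (FreeGroup S)) :=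
  {γ | ∃ h ∈ S', γ = SemidirectProduct.inl (atOne h)} ∪
  {γ | ∃ s : S, γ = SemidirectProduct.inr (FreeGroup.of s)}

/-- The (strong) equivariant `L¹`-compression `B₁` of a group `K` with respect to a word
length for the generating set `T` : the supremum of all `d ∈ [0,1]` for which some
left-invariant measured walls structure `μ` on `K` satisfies `d_μ(1,k) ≥ |k|^d` for all `k`. -/
noncomputable def Bone {K : Type*} [Group K] (T : Set K) : ℝ :=
  sSup {d : ℝ | 0 ≤ d ∧ d ≤ 1 ∧
    ∃ μ : WallMeasure K, IsMWS μ ∧ IsLeftInvariantWalls μ ∧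
      ∀ k : K, ENNReal.ofReal ((wordLength T k : ℝ) ^ d) ≤ wallDist μ 1 k}

section WordLength

variable {K L : Type*} [Group K] [Group L]

/-- `k` is a product of at most `c` elements of `T` and their inverses. -/
def IsWordProd (T : Set K) (c : ℝ≥0∞) (k : K) : Prop :=
  ∃ l : List K, (∀ x ∈ l, x ∈ T ∨ x⁻¹ ∈ T) ∧ l.prod = k ∧ (l.length : ℝ≥0∞) ≤ c

lemma IsWordProd.mono {T : Set K} {c c' : ℝ≥0∞} {k : K} (h : IsWordProd T c k) (hc : c ≤ c') :
    IsWordProd T c' k := by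
  obtain ⟨l, hl, hk, hlen⟩ := h
  exact ⟨l, hl, hk, hlen.trans hc⟩

lemma IsWordProd.one (T : Set K) (c : ℝ≥0∞) : IsWordProd T c 1 :=
  ⟨[], by simp, List.prod_nil, by simp⟩

lemma IsWordProd.of_mem {T : Set K} {k : K} (h : k ∈ T ∨ k⁻¹ ∈ T) : IsWordProd T 1 k :=
  ⟨[k], by simp [h], List.prod_singleton, by simp⟩

lemma IsWordProd.mul {T : Set K} {c c' : ℝ≥0∞} {k k' : K} (h : IsWordProd T c k)
    (h' : IsWordProd T c' k') : IsWordProd T (c + c') (k * k') := by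
  obtain ⟨l, hl, hk, hlen⟩ := h
  obtain ⟨l', hl', hk', hlen'⟩ := h'
  refine ⟨l ++ l', ?_, by simp [hk, hk'], ?_⟩
  · intro x hx
    rcases List.mem_append.1 hx with hx | hx
    exacts [hl x hx, hl' x hx]
  · simpa using add_le_add hlen hlen'

lemma IsWordProd.map {T : Set K} {U : Set L} (φ : K →* L) (hφ : ∀ t ∈ T, φ t ∈ U) {c : ℝ≥0∞}
    {k : K} (h : IsWordProd T c k) : IsWordProd U c (φ k) := by
  obtain ⟨l, hl, hk, hlen⟩ := h
  refine ⟨l.map φ, ?_, by rw [← hk, map_list_prod], by simpa using hlen⟩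
  intro x hx
  obtain ⟨y, hy, rfl⟩ := List.mem_map.1 hx
  rw [← map_inv]
  exact (hl y hy).imp (hφ y) (hφ _)

lemma IsWordProd.wordLength_le {T : Set K} {c : ℝ≥0∞} {k : K} (h : IsWordProd T c k) :
    (wordLength T k : ℝ≥0∞) ≤ c := by
  obtain ⟨l, hl, hk, hlen⟩ := h
  have hle : wordLength T k ≤ l.length := Nat.sInf_le ⟨l, rfl, hl, hk⟩
  exact le_trans (Nat.cast_le.2 hle) hlen

lemma IsWordProd.exists_length_eq {T : Set K} {c : ℝ≥0∞} {k : K} (h : IsWordProd T c k) :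
    IsWordProd T (wordLength T k) k := by
  obtain ⟨l, hl, hk, -⟩ := h
  obtain ⟨l', hlen', hl', hk'⟩ := Nat.sInf_mem
    (s := {n | ∃ l : List K, l.length = n ∧ (∀ x ∈ l, x ∈ T ∨ x⁻¹ ∈ T) ∧ l.prod = k})
    ⟨l.length, l, rfl, hl, hk⟩
  exact ⟨l', hl', hk', (congrArg Nat.cast hlen').le⟩

lemma isWordProd_of_closure_eq_top {T : Set K} (hT : Subgroup.closure T = ⊤) (k : K) :
    IsWordProd T (wordLength T k) k := by
  have hk : k ∈ (Subgroup.closure T).toSubmonoid := by simp [hT]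
  rw [Subgroup.closure_toSubmonoid] at hk
  obtain ⟨l, hl, hprod⟩ := Submonoid.exists_list_of_mem_closure hk
  exact IsWordProd.exists_length_eq (c := ⊤) ⟨l, hl, hprod, le_top⟩

@[simp]
lemma wordLength_one (T : Set K) : wordLength T (1 : K) = 0 := by
  simpa using (IsWordProd.one T 0).wordLength_le

lemma ofReal_wordLength_rpow {d : ℝ} (hd : 0 ≤ d) (T : Set K) (k : K) :
    ENNReal.ofReal ((wordLength T k : ℝ) ^ d) = (wordLength T k : ℝ≥0∞) ^ d := by
  rw [← ENNReal.ofReal_rpow_of_nonneg (Nat.cast_nonneg _) hd, ENNReal.ofReal_natCast]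

end WordLength

section WallMeasure

/-- The Borel σ-algebra on the power set, as used by `WallMeasure`. -/
@[reducible]
noncomputable def wallMeasurableSpace (X : Type*) : MeasurableSpace (X → Bool) := borel _

attribute [local instance] wallMeasurableSpace

local instance (X : Type*) : BorelSpace (X → Bool) := ⟨rfl⟩

variable {X Y Z : Type*}

lemma measurableSet_separating (x y : X) : MeasurableSet {A : X → Bool | A x ≠ A y} := by
  have h : IsOpen {A : X → Bool | A x ≠ A y} := by
    have hc : Continuous fun A : X → Bool => (A x, A y) := by fun_prop
    exact (isOpen_discrete {p : Bool × Bool | p.1 ≠ p.2}).preimage hc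
  exact h.measurableSet

lemma measurable_comp_right (f : Y → X) :
    Measurable fun (A : X → Bool) (y : Y) => A (f y) :=
  Continuous.measurable (by fun_prop)

lemma wallMap_comp_right (f : Y → X) (g : Z → Y) (μ : WallMeasure X) :
    wallMap (fun A z => A (g z)) (wallMap (fun A y => A (f y)) μ) =
      wallMap (fun A z => A (f (g z))) μ :=
  Measure.map_map (measurable_comp_right g) (measurable_comp_right f)

lemma wallDist_wallMap (f : Y → X) (μ : WallMeasure X) (x y : Y) :
    wallDist (wallMap (fun A y => A (f y)) μ) x y = wallDist μ (f x) (f y) :=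
  Measure.map_apply (measurable_comp_right f) (measurableSet_separating x y)

/-- The sum of a family of wall measures. -/
noncomputable def wallSum {ι : Type*} (ν : ι → WallMeasure X) : WallMeasure X := Measure.sum ν

lemma wallDist_wallSum {ι : Type*} (ν : ι → WallMeasure X) (x y : X) :
    wallDist (wallSum ν) x y = ∑' i, wallDist (ν i) x y :=
  Measure.sum_apply _ (measurableSet_separating x y)

lemma wallMap_wallSum {ι : Type*} (ν : ι → WallMeasure X) (f : Y → X) :
    wallMap (fun A y => A (f y)) (wallSum ν) = wallSum fun i => wallMap (fun A y => A (f y)) (ν i) :=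
  Measure.map_sum (measurable_comp_right f).aemeasurable

lemma wallSum_comp_equiv {ι ι' : Type*} (e : ι' ≃ ι) (ν : ι → WallMeasure X) :
    wallSum (fun i => ν (e i)) = wallSum ν :=
  Measure.sum_comp_equiv e ν

lemma isLeftInvariantWalls_wallSum {K ι : Type*} [Group K] (ν : ι → WallMeasure K)
    (h : ∀ k : K, ∃ e : ι ≃ ι, ∀ i, wallMap (fun A x => A (k⁻¹ * x)) (ν i) = ν (e i)) :
    IsLeftInvariantWalls (wallSum ν) := by
  intro k
  obtain ⟨e, he⟩ := h k
  rw [wallMap_wallSum ν fun x => k⁻¹ * x]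
  simp_rw [he]
  exact wallSum_comp_equiv e ν

/-- The wall measure giving mass one to every member of a family of half-spaces. -/
noncomputable def wallCount (E : Set (X → Bool)) : WallMeasure X :=
  wallSum fun A : E => (Measure.dirac (A : X → Bool) : Measure (X → Bool))

lemma wallDist_wallCount (E : Set (X → Bool)) (x y : X) :
    wallDist (wallCount E) x y = ∑' A : E, if (A : X → Bool) x ≠ (A : X → Bool) y then 1 else 0 := by
  rw [wallCount, wallDist_wallSum]
  refine tsum_congr fun A => ?_
  refine (Measure.dirac_apply' _ (measurableSet_separating x y)).trans ?_
  simp [Set.indicator_apply]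

lemma wallDist_wallCount_lt_top {E : Set (X → Bool)} {x y : X}
    (h : {A ∈ E | A x ≠ A y}.Finite) : wallDist (wallCount E) x y < ⊤ := by
  have hfin : {A : E | (A : X → Bool) x ≠ (A : X → Bool) y}.Finite := by
    refine Set.Finite.of_finite_image (f := Subtype.val) (h.subset ?_) Subtype.val_injective.injOn
    rintro _ ⟨A, hA, rfl⟩
    exact ⟨A.2, hA⟩
  rw [wallDist_wallCount, tsum_eq_sum (s := hfin.toFinset)]
  · refine ENNReal.sum_lt_top.2 fun A _ => ?_
    split_ifs <;> simp
  · intro A hA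
    simpa using hA

lemma card_le_wallDist_wallCount {E : Set (X → Bool)} {x y : X} {ι : Type*} (s : Finset ι)
    (f : ι → X → Bool) (hf : Set.InjOn f s) (hE : ∀ i ∈ s, f i ∈ E)
    (hs : ∀ i ∈ s, f i x ≠ f i y) : (s.card : ℝ≥0∞) ≤ wallDist (wallCount E) x y := by
  classical
  rw [wallDist_wallCount]
  have hinj : Function.Injective fun i : s => (⟨f i, hE i i.2⟩ : E) := fun i j hij =>
    Subtype.ext (hf i.2 j.2 (congrArg Subtype.val hij))
  calc (s.card : ℝ≥0∞)
      = ∑' i : {i // i ∈ s}, if f i.1 x ≠ f i.1 y then 1 else 0 := by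
        rw [tsum_fintype, Finset.sum_congr rfl fun (i : {i // i ∈ s}) _ => if_pos (hs i.1 i.2)]
        simp
    _ ≤ _ := ENNReal.tsum_comp_le_tsum_of_injective hinj
        fun A : E => if (A : X → Bool) x ≠ (A : X → Bool) y then 1 else 0

lemma isLeftInvariantWalls_wallCount {K : Type*} [Group K] {E : Set (K → Bool)}
    (hE : ∀ (k : K), ∀ A ∈ E, (fun x => A (k * x)) ∈ E) :
    IsLeftInvariantWalls (wallCount E) := by
  refine isLeftInvariantWalls_wallSum _ fun k => ⟨?_, fun A => ?_⟩
  · exact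
      { toFun := fun A => ⟨fun x => A.1 (k⁻¹ * x), hE _ _ A.2⟩
        invFun := fun A => ⟨fun x => A.1 (k * x), hE _ _ A.2⟩
        left_inv := fun A => by simp
        right_inv := fun A => by simp }
  · exact Measure.map_dirac' (measurable_comp_right _) _

lemma IsLeftInvariantWalls.add {K : Type*} [Group K] {μ ν : WallMeasure K}
    (hμ : IsLeftInvariantWalls μ) (hν : IsLeftInvariantWalls ν) :
    IsLeftInvariantWalls (μ + ν : WallMeasure K) := fun k =>
  (Measure.map_add μ ν (measurable_comp_right _)).trans (congrArg₂ (· + ·) (hμ k) (hν k))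

lemma wallDist_add (μ ν : WallMeasure X) (x y : X) :
    wallDist (μ + ν : WallMeasure X) x y = wallDist μ x y + wallDist ν x y := rfl

lemma isLeftInvariantWalls_comap {K L : Type*} [Group K] [Group L] (φ : L →* K)
    {μ : WallMeasure K} (hμ : IsLeftInvariantWalls μ) :
    IsLeftInvariantWalls (wallMap (fun A x => A (φ x)) μ) := by
  intro l
  rw [wallMap_comp_right φ fun x => l⁻¹ * x]
  conv_rhs => rw [← hμ (φ l)]
  rw [wallMap_comp_right (fun x => (φ l)⁻¹ * x) φ]
  simp

end WallMeasure
section FreeGroupTree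

variable {S : Type*} [DecidableEq S]

/-- The reduced word of the inverse; suffixes of `invWord x` correspond to the vertices on the
geodesic from `1` to `x` in the Cayley tree. -/
def invWord (x : FreeGroup S) : List (S × Bool) := x⁻¹.toWord

lemma invWord_injective : Function.Injective (invWord (S := S)) :=
  FreeGroup.toWord_injective.comp inv_injective

@[simp]
lemma invWord_one : invWord (1 : FreeGroup S) = [] := by simp [invWord]

lemma invWord_eq_nil {x : FreeGroup S} : invWord x = [] ↔ x = 1 := by
  rw [invWord, FreeGroup.toWord_eq_nil_iff, inv_eq_one]

lemma isReduced_invWord (x : FreeGroup S) : FreeGroup.IsReduced (invWord x) :=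
  FreeGroup.isReduced_toWord

lemma mk_invWord (x : FreeGroup S) : FreeGroup.mk (invWord x) = x⁻¹ := FreeGroup.mk_toWord

lemma invWord_inv_mk {L : List (S × Bool)} (hL : FreeGroup.IsReduced L) :
    invWord (FreeGroup.mk L)⁻¹ = L := by
  rw [invWord, inv_inv, FreeGroup.toWord_mk, hL.reduce_eq]

/-- The half-spaces of the Cayley tree of a free group. -/
def treeHalfSpaces (S : Type*) [DecidableEq S] : Set (Set (FreeGroup S)) :=
  {H | ∃ (k : FreeGroup S) (a : S × Bool), H = {x | (invWord (k⁻¹ * x)).getLast? ≠ some a}}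

lemma preimage_mem_treeHalfSpaces {H : Set (FreeGroup S)} (hH : H ∈ treeHalfSpaces S)
    (k : FreeGroup S) : {x | k * x ∈ H} ∈ treeHalfSpaces S := by
  obtain ⟨g, a, rfl⟩ := hH
  exact ⟨k⁻¹ * g, a, by simp [mul_assoc]⟩

lemma getLast?_invWord_mul_of {x : FreeGroup S} {s : S} (hx : x ≠ 1)
    (hxs : x * FreeGroup.of s ≠ 1) :
    (invWord (x * FreeGroup.of s)).getLast? = (invWord x).getLast? := by
  have h : invWord (x * FreeGroup.of s) = FreeGroup.reduce ((s, false) :: invWord x) := by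
    rw [← FreeGroup.toWord_mk, invWord, mul_inv_rev, ← mk_invWord x]
    rfl
  rw [Ne, ← invWord_eq_nil] at hx hxs
  have hr : FreeGroup.reduce (invWord x) = invWord x := (isReduced_invWord x).reduce_eq
  rw [FreeGroup.reduce.cons, hr] at h
  rcases hL : invWord x with _ | ⟨a, L⟩
  · exact absurd hL hx
  · rw [hL] at h
    dsimp only at h
    split_ifs at h with hc
    · rw [h] at hxs ⊢
      rcases L with _ | ⟨b, L⟩
      · exact absurd rfl hxs
      · simp
    · rw [h]
      simp

lemma finite_treeHalfSpaces_separating [Finite S] (x y : FreeGroup S) :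
    {H ∈ treeHalfSpaces S | ¬(x ∈ H ↔ y ∈ H)}.Finite := by
  have hof (x : FreeGroup S) (s : S) :
      {H ∈ treeHalfSpaces S | ¬(x ∈ H ↔ x * FreeGroup.of s ∈ H)}.Finite := by
    refine ((({x, x * FreeGroup.of s} : Set (FreeGroup S)).toFinite.prod
      (Set.finite_univ (α := S × Bool))).image fun p : FreeGroup S × (S × Bool) =>
        {x | (invWord (p.1⁻¹ * x)).getLast? ≠ some p.2}).subset ?_
    rintro _ ⟨⟨k, a, rfl⟩, hsep⟩
    refine ⟨(k, a), ⟨?_, Set.mem_univ _⟩, rfl⟩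
    by_contra hk
    simp only [Set.mem_insert_iff, Set.mem_singleton_iff, not_or] at hk
    refine hsep ?_
    simp only [Set.mem_ofPred_eq, ← mul_assoc]
    rw [getLast?_invWord_mul_of]
    · rw [Ne, inv_mul_eq_one]
      exact hk.1
    · rw [Ne, mul_assoc, inv_mul_eq_one]
      exact hk.2
  have key (g : FreeGroup S) :
      ∀ x, {H ∈ treeHalfSpaces S | ¬(x ∈ H ↔ x * g ∈ H)}.Finite := by
    induction g using FreeGroup.induction_on with
    | C1 => simp
    | of s => exact fun x => hof x s
    | inv_of s _ =>
      intro x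
      refine (hof (x * (FreeGroup.of s)⁻¹) s).subset fun H hH => ⟨hH.1, ?_⟩
      rw [inv_mul_cancel_right, iff_comm]
      exact hH.2
    | mul g h hg hh =>
      intro x
      refine ((hg x).union (hh (x * g))).subset fun H hH => ?_
      rw [← mul_assoc] at hH
      by_cases h1 : x ∈ H ↔ x * g ∈ H
      · exact Or.inr ⟨hH.1, fun h2 => hH.2 (h1.trans h2)⟩
      · exact Or.inl ⟨hH.1, h1⟩
  simpa using key (x⁻¹ * y) x

lemma compl_suffix_mem_treeHalfSpaces {u : FreeGroup S} (hu : u ≠ 1) :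
    {x | ¬ invWord u <:+ invWord x} ∈ treeHalfSpaces S := by
  rcases huL : invWord u with _ | ⟨a, L⟩
  · exact absurd (invWord_eq_nil.1 huL) hu
  have hred : FreeGroup.IsReduced (a :: L) := huL ▸ isReduced_invWord u
  refine ⟨(FreeGroup.mk L)⁻¹, a, Set.ext fun x => not_congr ?_⟩
  have hx : invWord ((FreeGroup.mk L)⁻¹⁻¹ * x) = (x⁻¹ * (FreeGroup.mk L)⁻¹).toWord := by
    simp [invWord]
  rw [hx, List.getLast?_eq_some_iff]
  constructor
  · rintro ⟨M, hM⟩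
    refine ⟨M, ?_⟩
    have hMred : FreeGroup.IsReduced (M ++ [a]) := by
      refine (isReduced_invWord x).infix ⟨[], L, ?_⟩
      simpa using hM
    rw [← mk_invWord x, ← hM, ← hMred.reduce_eq, ← FreeGroup.toWord_mk]
    congr 1
    rw [mul_inv_eq_iff_eq_mul, FreeGroup.mul_mk]
    simp
  · rintro ⟨M, hM⟩
    refine ⟨M, ?_⟩
    have hMred : FreeGroup.IsReduced (M ++ [a]) := hM ▸ FreeGroup.isReduced_toWord
    have hall : FreeGroup.IsReduced (M ++ a :: L) := by
      simpa using hMred.append_overlap (L₃ := L) hred (by simp)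
    have hxe : x⁻¹ = FreeGroup.mk (M ++ a :: L) := by
      have h := congrArg FreeGroup.mk hM
      rw [FreeGroup.mk_toWord, mul_inv_eq_iff_eq_mul, FreeGroup.mul_mk] at h
      simpa using h
    rw [invWord, hxe, FreeGroup.toWord_mk, hall.reduce_eq]

lemma exists_parent {u : FreeGroup S} (hu : u ≠ 1) :
    ∃ p b : FreeGroup S, u = p * b ∧ (∃ s, b = FreeGroup.of s ∨ b⁻¹ = FreeGroup.of s) ∧
      invWord p <:+ invWord u ∧ (invWord p).length < (invWord u).length := by
  rcases huL : invWord u with _ | ⟨⟨s, i⟩, L⟩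
  · exact absurd (invWord_eq_nil.1 huL) hu
  have hL : FreeGroup.IsReduced L := (huL ▸ isReduced_invWord u).infix ⟨[(s, i)], [], by simp⟩
  refine ⟨(FreeGroup.mk L)⁻¹, (FreeGroup.mk [(s, i)])⁻¹, ?_, ⟨s, ?_⟩, ?_, ?_⟩
  · rw [← mul_inv_rev, FreeGroup.mul_mk, ← inv_eq_iff_eq_inv, ← mk_invWord, huL]
    rfl
  · cases i
    · exact Or.inl rfl
    · exact Or.inr (inv_inv _)
  · rw [invWord_inv_mk hL]
    exact List.suffix_cons _ _
  · rw [invWord_inv_mk hL]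
    simp

end FreeGroupTree

section Tour

variable {F : Type*} [Group F]

/-- The vertices visited by the path that starts at `1` and follows the letters of a word. -/
def visited : List F → Set F
  | [] => {1}
  | a :: l => insert 1 ((fun x => a * x) '' visited l)

lemma one_mem_visited (l : List F) : 1 ∈ visited l := by
  cases l
  · exact Set.mem_singleton 1
  · exact Set.mem_insert _ _

lemma visited_append (l l' : List F) :
    visited (l ++ l') = visited l ∪ (fun x => l.prod * x) '' visited l' := by
  induction l with
  | nil =>
    simpa [visited] using (Set.insert_eq_of_mem (one_mem_visited l')).symm
  | cons a l ih =>
    simp only [List.cons_append, visited, ih, Set.image_union, Set.image_image,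
      Set.insert_union, List.prod_cons, mul_assoc]

lemma exists_append_of_mem_visited {l : List F} {x : F} (hx : x ∈ visited l) :
    ∃ l₁ l₂, l = l₁ ++ l₂ ∧ l₁.prod = x := by
  induction l generalizing x with
  | nil => exact ⟨[], [], rfl, (Set.mem_singleton_iff.1 hx).symm⟩
  | cons a l ih =>
    rcases hx with rfl | ⟨y, hy, rfl⟩
    · exact ⟨[], a :: l, rfl, rfl⟩
    · obtain ⟨l₁, l₂, rfl, rfl⟩ := ih hy
      exact ⟨a :: l₁, l₂, rfl, List.prod_cons⟩

/-- A finite rooted subtree can be toured by a path of length at most twice its number of edges,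
with any prescribed endpoint. -/
lemma exists_tour {B : Set F} (depth : F → ℕ) (T : Finset F) (h1 : 1 ∉ T)
    (hT : ∀ t ∈ T, ∃ p b : F, t = p * b ∧ (b ∈ B ∨ b⁻¹ ∈ B) ∧ (p = 1 ∨ p ∈ T) ∧
      depth p < depth t) :
    ∀ f, f = 1 ∨ f ∈ T → ∃ l : List F, (∀ b ∈ l, b ∈ B ∨ b⁻¹ ∈ B) ∧ l.prod = f ∧
      l.length ≤ 2 * T.card ∧ ∀ t ∈ T, t ∈ visited l := by
  classical
  induction T using Finset.induction_on_max_value depth with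
  | empty =>
    intro f hf
    exact ⟨[], by simp, by simpa [eq_comm] using hf, by simp, by simp⟩
  | insert t T htT hmax ih =>
    have ih' := ih (fun h => h1 (Finset.mem_insert_of_mem h)) fun u hu => by
      obtain ⟨p, b, hub, hb, hp, hlt⟩ := hT u (Finset.mem_insert_of_mem hu)
      refine ⟨p, b, hub, hb, hp.imp_right fun hp => ?_, hlt⟩
      refine Finset.mem_of_mem_insert_of_ne hp ?_
      rintro rfl
      exact absurd (hmax u hu) hlt.not_ge
    obtain ⟨p, b, rfl, hb, hp, hlt⟩ := hT t (Finset.mem_insert_self _ _)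
    have hp' : p = 1 ∨ p ∈ T := hp.imp_right fun hp =>
      Finset.mem_of_mem_insert_of_ne hp fun h => hlt.ne (congrArg depth h)
    intro f hf
    rw [Finset.card_insert_of_notMem htT]
    by_cases hft : f = p * b
    · obtain ⟨l, hl, hprod, hlen, hvis⟩ := ih' p hp'
      refine ⟨l ++ [b], ?_, by simp [hprod, hft], by simp; omega, ?_⟩
      · intro c hc
        rcases List.mem_append.1 hc with hc | hc
        · exact hl c hc
        · rw [List.mem_singleton.1 hc]
          exact hb
      · intro u hu
        rw [visited_append]
        rcases Finset.mem_insert.1 hu with rfl | hu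
        · exact Or.inr ⟨b, Or.inr ⟨1, one_mem_visited [], mul_one b⟩, by simp [hprod]⟩
        · exact Or.inl (hvis u hu)
    · have hf' : f = 1 ∨ f ∈ T := hf.imp_right fun hf => Finset.mem_of_mem_insert_of_ne hf hft
      obtain ⟨l, hl, hprod, hlen, hvis⟩ := ih' f hf'
      have hpl : p ∈ visited l := by
        rcases hp' with rfl | hp'
        exacts [one_mem_visited l, hvis p hp']
      obtain ⟨l₁, l₂, rfl, rfl⟩ := exists_append_of_mem_visited hpl
      refine ⟨(l₁ ++ [b, b⁻¹]) ++ l₂, ?_, ?_, ?_, ?_⟩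
      · intro c hc
        simp only [List.mem_append, List.mem_cons, List.not_mem_nil, or_false] at hc
        rcases hc with (hc | rfl | rfl) | hc
        · exact hl c (by simp [hc])
        · exact hb
        · simpa using hb.symm
        · exact hl c (by simp [hc])
      · simpa using hprod
      · simp only [List.length_append, List.length_cons, List.length_nil] at hlen ⊢
        omega
      · intro u hu
        rw [visited_append, visited_append]
        rcases Finset.mem_insert.1 hu with rfl | hu
        · refine Or.inl (Or.inr ⟨b, ?_, rfl⟩)
          exact Or.inr ⟨1, one_mem_visited [b⁻¹], mul_one b⟩
        · have h := hvis u hu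
          rw [visited_append] at h
          rcases h with h | h
          · exact Or.inl (Or.inl h)
          · exact Or.inr (by simpa using h)

end Tour
section Lamps

variable {G F : Type*} [Group G] [Group F]

/-- The value at `x` of the lamp configuration of an element of a wreath product. -/
def lampAt (γ : StandardWreath G F) (x : F) : G := (γ.left : F → G) x

lemma lampAt_mul (γ δ : StandardWreath G F) (x : F) :
    lampAt (γ * δ) x = lampAt γ x * lampAt δ (γ.right⁻¹ * x) := rfl

lemma lampAt_one (x : F) : lampAt (1 : StandardWreath G F) x = 1 := rfl

lemma lampAt_inr (f x : F) : lampAt (SemidirectProduct.inr f : StandardWreath G F) x = 1 := rfl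

open scoped Classical in
lemma lampAt_inl_atOne (g : G) (x : F) :
    lampAt (SemidirectProduct.inl (atOne g) : StandardWreath G F) x = if x = 1 then g else 1 := rfl

lemma wreath_ext {γ δ : StandardWreath G F} (hr : γ.right = δ.right)
    (hl : ∀ x, lampAt γ x = lampAt δ x) : γ = δ :=
  SemidirectProduct.ext (Subtype.ext (funext hl)) hr

lemma finite_lampAt_ne_one (γ : StandardWreath G F) : {x | lampAt γ x ≠ 1}.Finite := γ.left.2

lemma finite_lampAt_ne (γ δ : StandardWreath G F) : {x | lampAt γ x ≠ lampAt δ x}.Finite := by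
  refine ((finite_lampAt_ne_one γ).union (finite_lampAt_ne_one δ)).subset fun x hx => ?_
  by_contra h
  simp only [Set.mem_union, Set.mem_ofPred_eq, not_or, not_not] at h
  exact hx (h.1.trans h.2.symm)

/-- The embedding of `G` in `G ≀ F` as the functions supported at `1`. -/
noncomputable def lampHom (G F : Type*) [Group G] [Group F] : G →* StandardWreath G F where
  toFun g := SemidirectProduct.inl (atOne g)
  map_one' := wreath_ext rfl fun x => by
    rw [lampAt_inl_atOne, lampAt_one, ite_self]
  map_mul' g h := wreath_ext (by simp) fun x => by
    rw [lampAt_mul, SemidirectProduct.right_inl, inv_one, one_mul]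
    simp_rw [lampAt_inl_atOne]
    split_ifs <;> simp

open scoped Classical in
lemma lampAt_lampHom (g : G) (x : F) : lampAt (lampHom G F g) x = if x = 1 then g else 1 := rfl

lemma lampHom_right (g : G) : (lampHom G F g).right = 1 := rfl

/-- The walls on `G ≀ F` obtained by pulling back walls on `G` along all evaluation maps. -/
noncomputable def lampWalls (F : Type*) [Group F] (μ : WallMeasure G) :
    WallMeasure (StandardWreath G F) :=
  wallSum fun x : F => wallMap (fun A γ => A (lampAt γ x)) μ

lemma wallDist_lampWalls (μ : WallMeasure G) (γ δ : StandardWreath G F) :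
    wallDist (lampWalls F μ) γ δ = ∑' x, wallDist μ (lampAt γ x) (lampAt δ x) := by
  rw [lampWalls, wallDist_wallSum]
  exact tsum_congr fun x => wallDist_wallMap _ μ γ δ

lemma isMWS_lampWalls {μ : WallMeasure G} (hμ : IsMWS μ) : IsMWS (lampWalls F μ) := by
  intro γ δ
  rw [wallDist_lampWalls, tsum_eq_sum (s := (finite_lampAt_ne γ δ).toFinset)]
  · exact ENNReal.sum_lt_top.2 fun x _ => hμ _ _
  · intro x hx
    have hx' : lampAt γ x = lampAt δ x := by simpa using hx
    simp [hx', wallDist]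

lemma isLeftInvariantWalls_lampWalls {μ : WallMeasure G} (hμ : IsLeftInvariantWalls μ) :
    IsLeftInvariantWalls (lampWalls F μ) := by
  refine isLeftInvariantWalls_wallSum _ fun k => ⟨Equiv.mulLeft k.right, fun x => ?_⟩
  rw [wallMap_comp_right (fun γ => lampAt γ x) fun γ => k⁻¹ * γ]
  conv_rhs => rw [← hμ (lampAt k⁻¹ x)⁻¹]
  rw [wallMap_comp_right (fun y => (lampAt k⁻¹ x)⁻¹⁻¹ * y)]
  simp [lampAt_mul]

open scoped Classical in
/-- The set of elements of `G ≀ F` whose cursor is in `H` and whose lamps outside `H` agree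
with `w`. -/
noncomputable def wreathHalfSpace (H : Set F) (w : F → G) : StandardWreath G F → Bool :=
  fun γ => decide (γ.right ∈ H ∧ ∀ x, x ∉ H → lampAt γ x = w x)

lemma wreathHalfSpace_eq_true {H : Set F} {w : F → G} {γ : StandardWreath G F} :
    wreathHalfSpace H w γ = true ↔ γ.right ∈ H ∧ ∀ x, x ∉ H → lampAt γ x = w x := by
  simp [wreathHalfSpace]

/-- The half-spaces of `G ≀ F` associated with a family of half-spaces of `F`. -/
def wreathHalfSpaces (G : Type*) [Group G] (E : Set (Set F)) : Set (StandardWreath G F → Bool) :=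
  {A | ∃ H ∈ E, ∃ w : F → G, A = wreathHalfSpace H w}

lemma translate_mem_wreathHalfSpaces {E : Set (Set F)}
    (hE : ∀ H ∈ E, ∀ k : F, {x | k * x ∈ H} ∈ E) (k : StandardWreath G F) :
    ∀ A ∈ wreathHalfSpaces G E, (fun γ => A (k * γ)) ∈ wreathHalfSpaces G E := by
  rintro _ ⟨H, hH, w, rfl⟩
  refine ⟨_, hE H hH k.right,
    fun x => (lampAt k (k.right * x))⁻¹ * w (k.right * x), funext fun γ => ?_⟩
  rw [Bool.eq_iff_iff, wreathHalfSpace_eq_true, wreathHalfSpace_eq_true]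
  refine and_congr Iff.rfl ⟨fun h x hx => ?_, fun h x hx => ?_⟩
  · rw [eq_inv_mul_iff_mul_eq, ← h _ hx, lampAt_mul, inv_mul_cancel_left]
  · have := h (k.right⁻¹ * x) (by simpa using hx)
    rwa [mul_inv_cancel_left, eq_inv_mul_iff_mul_eq] at this

lemma finite_wreathHalfSpaces_separating {E : Set (Set F)}
    (hE : ∀ x y : F, {H ∈ E | ¬(x ∈ H ↔ y ∈ H)}.Finite) (γ δ : StandardWreath G F) :
    {A ∈ wreathHalfSpaces G E | A γ ≠ A δ}.Finite := by
  have key (γ δ : StandardWreath G F) :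
      {A ∈ wreathHalfSpaces G E | A γ = true ∧ A δ ≠ true}.Finite := by
    have hfin : (insert δ.right {x | lampAt γ x ≠ lampAt δ x}).Finite :=
      (finite_lampAt_ne γ δ).insert _
    refine ((hfin.biUnion fun z _ => hE γ.right z).image
      fun H => wreathHalfSpace H (lampAt γ)).subset ?_
    rintro _ ⟨⟨H, hH, w, rfl⟩, hγ, hδ⟩
    rw [wreathHalfSpace_eq_true] at hγ
    rw [Ne, wreathHalfSpace_eq_true] at hδ
    refine ⟨H, ?_, funext fun ε => ?_⟩
    · have hz : ∃ z ∈ insert δ.right {x | lampAt γ x ≠ lampAt δ x}, z ∉ H := by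
        by_contra! hz
        refine hδ ⟨hz _ (Set.mem_insert _ _), fun x hx => ?_⟩
        rw [← hγ.2 x hx]
        by_contra hne
        exact hx (hz x (Or.inr (Ne.symm hne)))
      obtain ⟨z, hz, hzH⟩ := hz
      exact Set.mem_biUnion hz ⟨hH, fun h => hzH (h.1 hγ.1)⟩
    · rw [Bool.eq_iff_iff, wreathHalfSpace_eq_true, wreathHalfSpace_eq_true]
      exact and_congr_right fun _ => forall₂_congr fun x hx => by rw [hγ.2 x hx]
  refine ((key γ δ).union (key δ γ)).subset ?_
  rintro A ⟨hA, hne⟩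
  cases h : A γ
  · exact Or.inr ⟨hA, by simpa [h] using hne.symm, by simp [h]⟩
  · exact Or.inl ⟨hA, h, by simpa [h] using hne.symm⟩

end Lamps

section WreathWords

variable {G S : Type*} [Group G]

lemma IsWordProd.lampAt {S' : Set G} {c : ℝ≥0∞} {γ : StandardWreath G (FreeGroup S)}
    (h : IsWordProd (wreathGen S' S) c γ) (x : FreeGroup S) : IsWordProd S' c (lampAt γ x) := by
  obtain ⟨l, hl, rfl, hlen⟩ := h
  refine IsWordProd.mono ?_ hlen
  clear hlen
  induction l generalizing x with
  | nil => exact IsWordProd.one _ _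
  | cons t l ih =>
    rw [List.prod_cons, lampAt_mul, List.length_cons, Nat.cast_succ, add_comm]
    refine IsWordProd.mul ?_ (ih _ fun y hy => hl y (List.mem_cons_of_mem _ hy))
    have hgen : ∀ t ∈ wreathGen S' S, ∀ y, _root_.lampAt t y ∈ S' ∨ _root_.lampAt t y = 1 := by
      rintro _ (⟨g, hg, rfl⟩ | ⟨s, rfl⟩) y
      · rw [lampAt_inl_atOne]
        split_ifs
        exacts [Or.inl hg, Or.inr rfl]
      · exact Or.inr rfl
    rcases hl t List.mem_cons_self with ht | ht
    · rcases hgen t ht x with h | h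
      · exact IsWordProd.of_mem (Or.inl h)
      · rw [h]
        exact IsWordProd.one _ _
    · have hinv : (_root_.lampAt t x)⁻¹ = _root_.lampAt t⁻¹ (t.right⁻¹ * x) := by
        rw [inv_eq_iff_mul_eq_one, ← lampAt_mul, mul_inv_cancel, lampAt_one]
      rcases hgen t⁻¹ ht (t.right⁻¹ * x) with h | h
      · exact IsWordProd.of_mem (Or.inr (hinv ▸ h))
      · rw [← hinv, inv_eq_one] at h
        rw [h]
        exact IsWordProd.one _ _

lemma isWordProd_lampHom {S' : Set G} (hgen : Subgroup.closure S' = ⊤) (g : G) :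
    IsWordProd (wreathGen S' S) (wordLength S' g) (lampHom G (FreeGroup S) g) :=
  IsWordProd.map (lampHom G (FreeGroup S)) (fun t ht => Or.inl ⟨t, ht, rfl⟩)
    (isWordProd_of_closure_eq_top hgen g)

/-- A path in `F` visiting all lit lamps yields a word for an element of `G ≀ F`. -/
lemma isWordProd_wreathGen_of_visited {S' : Set G} (hgen : Subgroup.closure S' = ⊤)
    (l : List (FreeGroup S))
    (hl : ∀ b ∈ l, b ∈ Set.range FreeGroup.of ∨ b⁻¹ ∈ Set.range FreeGroup.of)
    (γ : StandardWreath G (FreeGroup S)) (hγ : γ.right = l.prod)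
    (hvis : ∀ x, lampAt γ x ≠ 1 → x ∈ visited l) :
    IsWordProd (wreathGen S' S) (∑' x, (wordLength S' (lampAt γ x) : ℝ≥0∞) + l.length) γ := by
  classical
  induction l generalizing γ with
  | nil =>
    have hγ1 : γ = lampHom G (FreeGroup S) (lampAt γ 1) := by
      refine wreath_ext (hγ.trans (lampHom_right _).symm) fun x => ?_
      rw [lampAt_lampHom]
      split_ifs with hx
      · rw [hx]
      · by_contra h
        exact hx (hvis x h)
    have hw := isWordProd_lampHom (S := S) hgen (lampAt γ 1)
    rw [← hγ1] at hw
    refine hw.mono (le_add_right ?_)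
    exact ENNReal.le_tsum (f := fun x => (wordLength S' (lampAt γ x) : ℝ≥0∞)) 1
  | cons a l ih =>
    set g := lampAt γ 1 with hg
    set δ := lampHom G (FreeGroup S) g⁻¹ * γ with hδ
    set γ' : StandardWreath G (FreeGroup S) := SemidirectProduct.inr a⁻¹ * δ with hγ'
    have hlampδ (x) : lampAt δ x = if x = 1 then 1 else lampAt γ x := by
      rw [hδ, lampAt_mul, lampHom_right, lampAt_lampHom, inv_one, one_mul]
      split_ifs with hx
      · rw [hx, ← hg, inv_mul_cancel]
      · rw [one_mul]
    have hlampγ' (x) : lampAt γ' x = lampAt δ (a * x) := by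
      rw [hγ', lampAt_mul, lampAt_inr, one_mul, SemidirectProduct.right_inr, inv_inv]
    have hγ_eq : γ = lampHom G (FreeGroup S) g * (SemidirectProduct.inr a * γ') := by
      rw [hγ', hδ, map_inv, map_inv, mul_inv_cancel_left, mul_inv_cancel_left]
    have hright : γ'.right = l.prod := by
      rw [hγ', hδ]
      simp [lampHom_right, hγ]
    have hsum : ∑' x, (wordLength S' (lampAt γ x) : ℝ≥0∞) =
        wordLength S' g + ∑' x, (wordLength S' (lampAt γ' x) : ℝ≥0∞) := by
      rw [ENNReal.tsum_eq_add_tsum_ite 1, ← hg]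
      congr 1
      simp_rw [hlampγ']
      refine Eq.trans (tsum_congr fun x => ?_)
        ((Equiv.mulLeft a).tsum_eq fun x => (wordLength S' (lampAt δ x) : ℝ≥0∞)).symm
      rw [hlampδ]
      split_ifs <;> simp
    have ha : IsWordProd (wreathGen S' S) 1
        (SemidirectProduct.inr a : StandardWreath G (FreeGroup S)) := by
      refine IsWordProd.of_mem ?_
      rw [← map_inv]
      refine (hl a List.mem_cons_self).imp ?_ ?_ <;>
      · rintro ⟨s, hs⟩
        exact Or.inr ⟨s, by rw [hs]⟩
    have hγ'w := ih (fun b hb => hl b (List.mem_cons_of_mem _ hb)) γ' hright fun x hx => by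
      rw [hlampγ', hlampδ] at hx
      split_ifs at hx with h1
      · exact absurd rfl hx
      · rcases hvis _ hx with h | ⟨y, hy, hxy⟩
        · exact absurd h h1
        · rwa [← mul_left_cancel hxy]
    rw [hγ_eq]
    refine ((isWordProd_lampHom hgen g).mul (ha.mul hγ'w)).mono ?_
    rw [← hγ_eq, hsum, List.length_cons, Nat.cast_succ, add_assoc]
    refine le_of_eq ?_
    ring

end WreathWords

section Compression

lemma ENNReal.tsum_rpow_le {ι : Type*} {f : ι → ℝ≥0∞} {d : ℝ} (hd : 0 < d) (hd1 : d ≤ 1)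
    (hf : {i | f i ≠ 0}.Finite) : (∑' i, f i) ^ d ≤ ∑' i, f i ^ d := by
  classical
  have hsum (s : Finset ι) : (∑ i ∈ s, f i) ^ d ≤ ∑ i ∈ s, f i ^ d := by
    induction s using Finset.induction_on with
    | empty => simp [hd]
    | insert i s hi ih =>
      rw [Finset.sum_insert hi, Finset.sum_insert hi]
      exact (ENNReal.rpow_add_le_add_rpow _ _ hd.le hd1).trans (by gcongr)
  rw [tsum_eq_sum (s := hf.toFinset) fun i hi => by simpa using hi]
  exact (hsum _).trans (ENNReal.sum_le_tsum _)

lemma natCast_rpow_le {d : ℝ} (hd : 0 < d) (hd1 : d ≤ 1) (n : ℕ) : (n : ℝ≥0∞) ^ d ≤ n := by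
  rcases Nat.eq_zero_or_pos n with rfl | hn
  · simp [hd]
  · have h1 : (1 : ℝ≥0∞) ≤ n := by exact_mod_cast hn
    simpa using ENNReal.rpow_le_rpow_of_exponent_le h1 hd1

variable {G S : Type*} [Group G]

/-- The walls on `G ≀ F(S)` coming from the Cayley tree of `F(S)`. -/
noncomputable def treeWalls (G S : Type*) [Group G] [DecidableEq S] :
    WallMeasure (StandardWreath G (FreeGroup S)) :=
  wallCount (wreathHalfSpaces G (treeHalfSpaces S))

lemma isMWS_treeWalls [DecidableEq S] [Finite S] : IsMWS (treeWalls G S) := fun γ δ =>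
  wallDist_wallCount_lt_top
    (finite_wreathHalfSpaces_separating finite_treeHalfSpaces_separating γ δ)

lemma isLeftInvariantWalls_treeWalls [DecidableEq S] : IsLeftInvariantWalls (treeWalls G S) :=
  isLeftInvariantWalls_wallCount fun k =>
    translate_mem_wreathHalfSpaces (fun _ hH => preimage_mem_treeHalfSpaces hH) k

/-- The nontrivial vertices of the subtree of the Cayley tree of `F(S)` spanned by `1`, the cursor
and the lit lamps. -/
def hullVertices [DecidableEq S] (γ : StandardWreath G (FreeGroup S)) : Set (FreeGroup S) :=
  {u | u ≠ 1 ∧ ∃ z ∈ insert γ.right {x | lampAt γ x ≠ 1}, invWord u <:+ invWord z}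

lemma finite_hullVertices [DecidableEq S] (γ : StandardWreath G (FreeGroup S)) :
    (hullVertices γ).Finite := by
  have hfin : (insert γ.right {x | lampAt γ x ≠ 1}).Finite := (finite_lampAt_ne_one γ).insert _
  refine Set.Finite.of_finite_image (f := invWord) ?_ invWord_injective.injOn
  refine (hfin.biUnion fun z _ => (invWord z).tails.finite_toSet).subset ?_
  rintro _ ⟨u, ⟨-, z, hz, huz⟩, rfl⟩
  exact Set.mem_biUnion hz ((List.mem_tails _ _).2 huz)

lemma card_hullVertices_le_wallDist [DecidableEq S] (γ : StandardWreath G (FreeGroup S)) :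
    ((finite_hullVertices γ).toFinset.card : ℝ≥0∞) ≤ wallDist (treeWalls G S) 1 γ := by
  refine card_le_wallDist_wallCount _
    (fun u => wreathHalfSpace {x | ¬ invWord u <:+ invWord x} 1) ?_ ?_ ?_
  · intro u _ v _ huv
    have h (x : FreeGroup S) : ¬ invWord u <:+ invWord x ↔ ¬ invWord v <:+ invWord x := by
      have h := congrFun huv (SemidirectProduct.inr x)
      rw [Bool.eq_iff_iff, wreathHalfSpace_eq_true, wreathHalfSpace_eq_true] at h
      have h1 (y : FreeGroup S) :
          lampAt (SemidirectProduct.inr x : StandardWreath G (FreeGroup S)) y = (1 : FreeGroup S → G) y := rfl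
      exact (and_iff_left fun y _ => h1 y).symm.trans (h.trans (and_iff_left fun y _ => h1 y))
    have huv' : invWord u <:+ invWord v := not_iff_not.1 (h v) |>.2 List.suffix_rfl
    have hvu : invWord v <:+ invWord u := not_iff_not.1 (h u) |>.1 List.suffix_rfl
    exact invWord_injective (huv'.eq_of_length (le_antisymm huv'.length_le hvu.length_le))
  · intro u hu
    have hu : u ∈ hullVertices γ := by simpa using hu
    exact ⟨_, compl_suffix_mem_treeHalfSpaces hu.1, 1, rfl⟩
  · intro u hu
    obtain ⟨hu1, z, hz, huz⟩ : u ∈ hullVertices γ := by simpa using hu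
    have h1 : wreathHalfSpace {x | ¬ invWord u <:+ invWord x} 1
        (1 : StandardWreath G (FreeGroup S)) = true := by
      rw [wreathHalfSpace_eq_true]
      exact ⟨by simpa [invWord_eq_nil] using hu1, fun x _ => rfl⟩
    rw [h1, ne_comm, Ne, wreathHalfSpace_eq_true]
    rintro ⟨hr, hl⟩
    rcases hz with rfl | hz
    · exact hr huz
    · exact hz (hl z (not_not.2 huz))

lemma wordLength_wreathGen_le [DecidableEq S] {S' : Set G} (hgen : Subgroup.closure S' = ⊤)
    (γ : StandardWreath G (FreeGroup S)) :
    (wordLength (wreathGen S' S) γ : ℝ≥0∞) ≤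
      ∑' x, (wordLength S' (lampAt γ x) : ℝ≥0∞) +
        (2 * (finite_hullVertices γ).toFinset.card : ℕ) := by
  have hmem (z) (hz : z ∈ insert γ.right {x | lampAt γ x ≠ 1}) :
      z = 1 ∨ z ∈ (finite_hullVertices γ).toFinset := by
    by_cases h : z = 1
    · exact Or.inl h
    · exact Or.inr ((finite_hullVertices γ).mem_toFinset.2 ⟨h, z, hz, List.suffix_rfl⟩)
  obtain ⟨l, hl, hprod, hlen, hvis⟩ := exists_tour (B := Set.range FreeGroup.of)
    (fun u : FreeGroup S => (invWord u).length) (finite_hullVertices γ).toFinset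
    (by simp [hullVertices]) (fun u hu => by
      obtain ⟨hu1, z, hz, huz⟩ := (finite_hullVertices γ).mem_toFinset.1 hu
      obtain ⟨p, b, hub, ⟨s, hb⟩, hp, hlt⟩ := exists_parent hu1
      refine ⟨p, b, hub, hb.imp (fun h => ⟨s, h.symm⟩) fun h => ⟨s, h.symm⟩, ?_, hlt⟩
      by_cases h : p = 1
      · exact Or.inl h
      · exact Or.inr ((finite_hullVertices γ).mem_toFinset.2 ⟨h, z, hz, hp.trans huz⟩))
    γ.right (hmem _ (Set.mem_insert _ _))
  refine (isWordProd_wreathGen_of_visited hgen l hl γ hprod.symm fun x hx => ?_).wordLength_le.trans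
    (by gcongr)
  rcases hmem x (Set.mem_insert_of_mem _ hx) with rfl | hx
  · exact one_mem_visited l
  · exact hvis x hx

lemma wordLength_le_wordLength_lampHom {S' : Set G} (hgen : Subgroup.closure S' = ⊤) (g : G) :
    wordLength S' g ≤ wordLength (wreathGen S' S) (lampHom G (FreeGroup S) g) := by
  have h1 := ((isWordProd_lampHom (S := S) hgen g).exists_length_eq.lampAt 1).wordLength_le
  rw [lampAt_lampHom, if_pos rfl] at h1
  exact_mod_cast h1

end Compression

/-- **Theorem.** For a finitely generated group `G` and a finitely generated free group
`F = F(S)`, the equivariant `L¹`-compression of `G ≀ F` equals that of `G`. -/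
theorem wreath_free_L1_compression (G : Type*) [Group G]
    (S' : Finset G) (hgen : Subgroup.closure (S' : Set G) = ⊤)
    (S : Type*) [Finite S] :
    Bone (wreathGen (S' : Set G) S) = Bone (S' : Set G) := by
  classical
  unfold Bone
  congr 1
  ext d
  refine and_congr_right fun hd => and_congr_right fun hd1 => ⟨?_, ?_⟩
  · rintro ⟨μ, hμ, hinv, hcomp⟩
    refine ⟨wallMap (fun A x => A (lampHom G (FreeGroup S) x)) μ, fun x y => ?_,
      isLeftInvariantWalls_comap _ hinv, fun g => ?_⟩
    · rw [wallDist_wallMap]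
      exact hμ _ _
    · rw [wallDist_wallMap, map_one]
      refine le_trans ?_ (hcomp _)
      gcongr
      exact wordLength_le_wordLength_lampHom hgen g
  · rintro ⟨μ, hμ, hinv, hcomp⟩
    have hd0 : 0 < d := by
      refine hd.lt_of_ne' ?_
      rintro rfl
      simpa [wallDist] using hcomp 1
    refine ⟨(lampWalls (FreeGroup S) μ + (treeWalls G S + treeWalls G S : WallMeasure _) :
        WallMeasure _), fun γ δ => ?_,
      (isLeftInvariantWalls_lampWalls hinv).add
        (isLeftInvariantWalls_treeWalls.add isLeftInvariantWalls_treeWalls), fun γ => ?_⟩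
    · rw [wallDist_add, wallDist_add]
      exact ENNReal.add_lt_top.2 ⟨isMWS_lampWalls hμ γ δ,
        ENNReal.add_lt_top.2 ⟨isMWS_treeWalls γ δ, isMWS_treeWalls γ δ⟩⟩
    · rw [wallDist_add, wallDist_add, ofReal_wordLength_rpow hd]
      refine (ENNReal.rpow_le_rpow (wordLength_wreathGen_le hgen γ) hd).trans ?_
      refine (ENNReal.rpow_add_le_add_rpow _ _ hd hd1).trans (add_le_add ?_ ?_)
      · refine (ENNReal.tsum_rpow_le hd0 hd1 ?_).trans ?_
        · refine (finite_lampAt_ne_one γ).subset fun x hx h => hx ?_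
          simp [h]
        · rw [wallDist_lampWalls]
          refine ENNReal.tsum_le_tsum fun x => ?_
          rw [← ofReal_wordLength_rpow hd]
          exact hcomp _
      · refine (natCast_rpow_le hd0 hd1 _).trans ?_
        rw [two_mul, Nat.cast_add]
        exact add_le_add (card_hullVertices_le_wallDist γ) (card_hullVertices_le_wallDist γ)
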